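/- arXiv:hep-th/9509094 — 2 statements merged into one kernel-verified Lean document; each statement's English description precedes it below -/
import Mathlib

section
/- Let G_I(t,q₀,…,q_{2k−2},p⁰) be smooth, let γ₁,…,γ_m : (q₀,…,q_k) → ℝⁿ be smooth with W(q₀,…,q_k)γ_μ = 0 pointwise, and let r¹,…,r^m be smooth real functions of (t,q₀,…,q_{2k−1}), such that K₀·G_I + Σ_{μ=1}^{m} r^μ ⟨[L],γ_μ⟩ = 0 holds identically (since Wγ_μ = 0 and W is symmetric, ⟨[L],γ_μ⟩ does not depend on q_{2k}, so the left-hand side is a function of (t,q₀,…,q_{2k−1})). Then δq := (∂G_I/∂p⁰)∘F₀ + Σ_{μ=1}^{m} r^μ γ_μ satisfies ⟨[L],δq⟩ + D_t(G_I∘F₀) = 0 identically as functions of (t,q₀,…,q_{2k}); that is, δq is a Noether transformation with conserved quantity G_L = G_I∘F₀ (converse part of the paper's Theorem 1). -/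
open scoped BigOperators

noncomputable section

/-- `Vec n` is `ℝⁿ`. -/
abbrev Vec (n : ℕ) := Fin n → ℝ

/-- `Jet n m` packages the variables `q₀, …, q_m`, each a vector of `ℝⁿ`. -/
abbrev Jet (n m : ℕ) := Fin (m+1) → Vec n

/-- The standard inner product on `ℝⁿ`. -/
def dot {n : ℕ} (u v : Vec n) : ℝ := ∑ a, u a * v a

/-- Forget the top variable `q_{m+1}`. -/
def res {n m : ℕ} (q : Jet n (m+1)) : Jet n m := fun i => q i.castSucc

/-- The shift `(shft q) i = q (i+1)`. -/
def shft {n m : ℕ} (q : Jet n (m+1)) : Jet n m := fun i => q i.succ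

/-- Restriction of a jet to a lower-order jet. -/
def trunc {n m m' : ℕ} (h : m' ≤ m) (q : Jet n m) : Jet n m' :=
  fun i => q (Fin.castLE (Nat.succ_le_succ h) i)

/-- The partial gradient of `f` in the slot `q_i`, identified with a vector of `ℝⁿ`
via the standard inner product (i.e. the vector representing the partial
differential `∂f/∂q_i`). -/
def gradSlot {n m : ℕ} (f : Jet n m → ℝ) (q : Jet n m) (i : Fin (m+1)) : Vec n :=
  fun a => fderiv ℝ f q (Pi.single i (Pi.single a 1))

/-- The formal total time derivative of a time-independent function
`f(q₀,…,q_m)`: `D_t f = Σ_i (∂f/∂q_i)·q_{i+1}`, a function of `(q₀,…,q_{m+1})`. -/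
def Dt0 {n m : ℕ} {F : Type*} [NormedAddCommGroup F] [NormedSpace ℝ F]
    (f : Jet n m → F) (q : Jet n (m+1)) : F :=
  fderiv ℝ f (res q) (shft q)

/-- Iterated formal total time derivative (time-independent functions). -/
def DtIter0 {n m : ℕ} {F : Type*} [NormedAddCommGroup F] [NormedSpace ℝ F] :
    (r : ℕ) → (Jet n m → F) → (Jet n (m + r) → F)
  | 0, f => f
  | r+1, f => Dt0 (DtIter0 r f)

/-- The formal total time derivative of a time-dependent function
`f(t,q₀,…,q_m)`: `D_t f = ∂f/∂t + Σ_i (∂f/∂q_i)·q_{i+1}`. -/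
def Dt {n m : ℕ} {F : Type*} [NormedAddCommGroup F] [NormedSpace ℝ F]
    (f : ℝ × Jet n m → F) (x : ℝ × Jet n (m+1)) : F :=
  fderiv ℝ f (x.1, res x.2) (1, shft x.2)

/-- Iterated formal total time derivative (time-dependent functions). -/
def DtIter {n m : ℕ} {F : Type*} [NormedAddCommGroup F] [NormedSpace ℝ F] :
    (r : ℕ) → (ℝ × Jet n m → F) → (ℝ × Jet n (m + r) → F)
  | 0, f => f
  | r+1, f => Dt (DtIter r f)

/-- The partial gradient in the slot `q_i` of a time-dependent function. -/
def gradSlotT {n m : ℕ} (f : ℝ × Jet n m → ℝ) (x : ℝ × Jet n m) (i : Fin (m+1)) : Vec n :=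
  fun a => fderiv ℝ f x (0, Pi.single i (Pi.single a 1))

/-- The Ostrogradskii momenta of a Lagrangian `L(q₀,…,q_{k+1})` of order `k+1`:
`mom L j` is the momentum `p̂^{k-j}`, a function of `(q₀,…,q_{k+j+1})`.
It is defined by the downward recursion `p̂^{k} = ∂L/∂q_{k+1}` and
`p̂^{i-1} = ∂L/∂q_i − D_t p̂^i`. -/
def mom {n k : ℕ} (L : Jet n (k+1) → ℝ) : (j : ℕ) → (Jet n (k + j + 1) → Vec n)
  | 0 => fun q => gradSlot L q (Fin.last (k+1))
  | j+1 => fun q =>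
      gradSlot L (trunc (by omega) q) ⟨k - j, by omega⟩ - Dt0 (mom L j) q

/-- The Euler–Lagrange expression `[L] = Σ_{r=0}^{k+1} (−1)^r D_t^r (∂L/∂q_r)`
of a Lagrangian of order `k+1`, a function of `(q₀,…,q_{2(k+1)})`. -/
def EL {n k : ℕ} (L : Jet n (k+1) → ℝ) (q : Jet n (k+k+2)) : Vec n :=
  ∑ r : Fin (k+2),
    ((-1 : ℝ)) ^ (r : ℕ) •
      DtIter0 (r : ℕ) (fun q' => gradSlot L q' r)
        (trunc (by have := r.isLt; omega) q)

/-- The Hessian `W = ∂²L/∂q_{k+1}∂q_{k+1}` of a Lagrangian of order `k+1`,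
as an operator `ℝⁿ → ℝⁿ` (a function of `(q₀,…,q_{k+1})`). -/
def hessOp {n k : ℕ} (L : Jet n (k+1) → ℝ) (q : Jet n (k+1)) (v : Vec n) : Vec n :=
  fun a => fderiv ℝ (fun q' => gradSlot L q' (Fin.last (k+1)) a) q
    (Pi.single (Fin.last (k+1)) v)

/-- The first partial Legendre–Ostrogradskii transformation
`F₀ : (q₀,…,q_{2k+1}) ↦ (q₀,…,q_{2k}; p̂⁰)`. -/
def F0 {n k : ℕ} (L : Jet n (k+1) → ℝ) (q : Jet n (k+k+1)) : Jet n (k+k) × Vec n :=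
  (res q, mom L k q)

/-- Pull-back through `F₀` of a (time-dependent) function on the intermediate
space `P₁`. -/
def pullF0 {n k : ℕ} {F : Type*} (L : Jet n (k+1) → ℝ)
    (g : ℝ × (Jet n (k+k) × Vec n) → F) (x : ℝ × Jet n (k+k+1)) : F :=
  g (x.1, F0 L x.2)

/-- The intermediate evolution operator `K₀`:
`K₀·g = (∂g/∂t)∘F₀ + Σ_{i=0}^{2k} ((∂g/∂q_i)∘F₀)·q_{i+1} + ((∂g/∂p⁰)∘F₀)·(∂L/∂q₀)`. -/
def K0 {n k : ℕ} {F : Type*} [NormedAddCommGroup F] [NormedSpace ℝ F]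
    (L : Jet n (k+1) → ℝ)
    (g : ℝ × (Jet n (k+k) × Vec n) → F) (x : ℝ × Jet n (k+k+1)) : F :=
  fderiv ℝ g (x.1, F0 L x.2)
    (1, shft x.2, gradSlot L (trunc (by omega) x.2) 0)

/-- The partial gradient `∂g/∂p⁰` of a function on `P₁`, as a vector of `ℝⁿ`. -/
def gradMom {n k : ℕ} (g : ℝ × (Jet n (k+k) × Vec n) → ℝ)
    (x : ℝ × (Jet n (k+k) × Vec n)) : Vec n :=
  fun a => fderiv ℝ g x (0, 0, Pi.single a 1)

/-- `trunc` as a continuous linear map. -/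
def truncCLM {n m m' : ℕ} (h : m' ≤ m) : Jet n m →L[ℝ] Jet n m' :=
  ContinuousLinearMap.pi fun i => ContinuousLinearMap.proj (Fin.castLE (Nat.succ_le_succ h) i)

/-- `res` as a continuous linear map. -/
def resCLM {n m : ℕ} : Jet n (m+1) →L[ℝ] Jet n m :=
  ContinuousLinearMap.pi fun i => ContinuousLinearMap.proj i.castSucc

/-- `shft` as a continuous linear map. -/
def shftCLM {n m : ℕ} : Jet n (m+1) →L[ℝ] Jet n m :=
  ContinuousLinearMap.pi fun i => ContinuousLinearMap.proj i.succ

theorem contDiff_Dt0 {n m : ℕ} {F : Type*} [NormedAddCommGroup F] [NormedSpace ℝ F]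
    {f : Jet n m → F} (hf : ContDiff ℝ (⊤ : ℕ∞) f) : ContDiff ℝ (⊤ : ℕ∞) (Dt0 f) :=
  ((hf.fderiv_right (m := (⊤ : ℕ∞)) (by simp)).comp (resCLM (n := n) (m := m)).contDiff).clm_apply
    (shftCLM (n := n) (m := m)).contDiff

theorem contDiff_DtIter0 {n m : ℕ} {F : Type*} [NormedAddCommGroup F] [NormedSpace ℝ F]
    {f : Jet n m → F} (hf : ContDiff ℝ (⊤ : ℕ∞) f) (r : ℕ) :
    ContDiff ℝ (⊤ : ℕ∞) (DtIter0 r f) := by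
  induction r with
  | zero => exact hf
  | succ r ih => exact contDiff_Dt0 ih

theorem contDiff_gradSlot {n m : ℕ} {f : Jet n m → ℝ} (hf : ContDiff ℝ (⊤ : ℕ∞) f)
    (i : Fin (m+1)) : ContDiff ℝ (⊤ : ℕ∞) (fun q => gradSlot f q i) :=
  contDiff_pi.2 fun _ =>
    (hf.fderiv_right (m := (⊤ : ℕ∞)) (by simp)).clm_apply contDiff_const

theorem differentiable_DtIter0_gradSlot {n m : ℕ} {f : Jet n m → ℝ}
    (hf : ContDiff ℝ (⊤ : ℕ∞) f) (i : Fin (m+1)) (r : ℕ) :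
    Differentiable ℝ (DtIter0 r (fun q => gradSlot f q i)) :=
  (contDiff_DtIter0 (contDiff_gradSlot hf i) r).differentiable (by simp)

theorem contDiff_trunc {n m m' : ℕ} (h : m' ≤ m) :
    ContDiff ℝ (⊤ : ℕ∞) (trunc h : Jet n m → Jet n m') :=
  (truncCLM h).contDiff

theorem contDiff_mom {n k : ℕ} {L : Jet n (k+1) → ℝ} (hL : ContDiff ℝ (⊤ : ℕ∞) L) (j : ℕ) :
    ContDiff ℝ (⊤ : ℕ∞) (mom L j) := by
  induction j with
  | zero => exact contDiff_gradSlot hL _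
  | succ j ih =>
    exact ((contDiff_gradSlot hL _).comp (contDiff_trunc (by omega))).sub (contDiff_Dt0 ih)

/-- The total time derivative commutes with pulling back along `trunc`. -/
theorem Dt0_comp_trunc {n m m' : ℕ} {F : Type*} [NormedAddCommGroup F] [NormedSpace ℝ F]
    {f : Jet n m' → F} (hf : Differentiable ℝ f) (h : m' ≤ m) (q : Jet n (m+1)) :
    Dt0 (fun q' => f (trunc h q')) q = Dt0 f (trunc (Nat.succ_le_succ h) q) := by
  have H : HasFDerivAt (fun q' : Jet n m => f (trunc h q'))
      ((fderiv ℝ f (trunc h (res q))).comp (truncCLM h)) (res q) :=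
    (hf (trunc h (res q))).hasFDerivAt.comp (res q) (truncCLM h).hasFDerivAt
  rw [Dt0, H.fderiv]
  rfl

/-- The total time derivative of a linear combination of smooth functions of lower-order jets. -/
theorem Dt0_sum_smul_trunc {n m : ℕ} {ι F : Type*} [Fintype ι] [NormedAddCommGroup F]
    [NormedSpace ℝ F] (c : ι → ℝ) {a : ι → ℕ} {f : (i : ι) → Jet n (a i) → F}
    (hf : ∀ i, Differentiable ℝ (f i)) (h : ∀ i, a i ≤ m) (q : Jet n (m+1)) :
    Dt0 (fun q' => ∑ i, c i • f i (trunc (h i) q')) q =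
      ∑ i, c i • Dt0 (f i) (trunc (Nat.succ_le_succ (h i)) q) := by
  have hd (i : ι) : Differentiable ℝ (fun q' : Jet n m => f i (trunc (h i) q')) :=
    (hf i).comp (truncCLM (h i)).differentiable
  have H : HasFDerivAt (fun q' => ∑ i, c i • f i (trunc (h i) q'))
      (∑ i, c i • fderiv ℝ (fun q' => f i (trunc (h i) q')) (res q)) (res q) :=
    HasFDerivAt.fun_sum fun i _ => (hd i (res q)).hasFDerivAt.const_smul (c i)
  rw [Dt0, H.fderiv, _root_.sum_apply]
  exact Finset.sum_congr rfl fun i _ => congrArg (c i • ·) (Dt0_comp_trunc (hf i) (h i) q)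

/-- Closed form of the Ostrogradskii momenta. -/
theorem mom_eq_sum {n k : ℕ} {L : Jet n (k+1) → ℝ} (hL : ContDiff ℝ (⊤ : ℕ∞) L)
    (j : ℕ) (hj : j ≤ k) (q : Jet n (k+j+1)) :
    mom L j q = ∑ s : Fin (j+1), ((-1 : ℝ)) ^ (s : ℕ) •
      DtIter0 (s : ℕ) (fun q' => gradSlot L q' ⟨k + 1 - j + s, by omega⟩)
        (trunc (by omega) q) := by
  induction j with
  | zero =>
    rw [Fin.sum_univ_one]
    simp only [Fin.val_zero, pow_zero, one_smul]
    rfl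
  | succ j ih =>
    have hmom : mom L j = _ := funext (ih (by omega))
    simp only [mom]
    rw [hmom, Dt0_sum_smul_trunc _
      (fun _ => differentiable_DtIter0_gradSlot hL _ _) fun s => by omega, sub_eq_add_neg,
      ← Finset.sum_neg_distrib]
    conv_rhs => rw [Fin.sum_univ_succ]
    congr 1
    · simp only [Fin.val_zero, pow_zero, one_smul]
      change gradSlot L _ _ = gradSlot L _ _
      congr 2
      simp
    · refine Finset.sum_congr rfl fun s _ => ?_
      have e : (⟨k + 1 - j + s, by omega⟩ : Fin (k+1+1)) =
          ⟨k + 1 - (j+1) + (s.succ : Fin (j+2)), by simp; omega⟩ := by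
        ext; simp; omega
      rw [e, ← neg_smul]
      congr 1
      simp [pow_succ]

/-- The Euler–Lagrange expression is `∂L/∂q₀ − D_t p̂⁰`. -/
theorem EL_eq_gradSlot_sub_Dt0_mom {n k : ℕ} {L : Jet n (k+1) → ℝ}
    (hL : ContDiff ℝ (⊤ : ℕ∞) L) (q : Jet n (k+k+2)) :
    EL L q = gradSlot L (trunc (by omega) q) 0 - Dt0 (mom L k) q := by
  have hmom : mom L k = _ := funext (mom_eq_sum hL k le_rfl)
  rw [EL, hmom, Dt0_sum_smul_trunc _
      (fun _ => differentiable_DtIter0_gradSlot hL _ _) fun s => by omega, Fin.sum_univ_succ, sub_eq_add_neg,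
    ← Finset.sum_neg_distrib]
  congr 1
  · simp only [Fin.val_zero, pow_zero, one_smul]
    rfl
  · refine Finset.sum_congr rfl fun s _ => ?_
    have e : (⟨k + 1 - k + s, by omega⟩ : Fin (k+1+1)) = s.succ := by
      ext; simp; omega
    rw [e, ← neg_smul]
    congr 1
    simp [pow_succ]

theorem Dt_pullF0 {n k : ℕ} {L : Jet n (k+1) → ℝ} (hL : ContDiff ℝ (⊤ : ℕ∞) L)
    {g : ℝ × (Jet n (k+k) × Vec n) → ℝ} (hg : Differentiable ℝ g)
    (t : ℝ) (q : Jet n (k+k+2)) :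
    Dt (pullF0 L g) (t, q) =
      fderiv ℝ g (t, F0 L (res q)) (1, shft (res q), Dt0 (mom L k) q) := by
  have hm : HasFDerivAt (mom L k) (fderiv ℝ (mom L k) (res q)) (res q) :=
    (((contDiff_mom hL k).differentiable (by simp)) _).hasFDerivAt
  have hF : HasFDerivAt (F0 L) ((resCLM (n := n) (m := k+k)).prod (fderiv ℝ (mom L k) (res q)))
      (res q) :=
    (resCLM (n := n) (m := k+k)).hasFDerivAt.prodMk hm
  have hp := (hasFDerivAt_fst (𝕜 := ℝ) (p := (t, (res q : Jet n (k+k+1))))).prodMk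
    (HasFDerivAt.comp (t, (res q : Jet n (k+k+1))) (f := Prod.snd) hF hasFDerivAt_snd)
  have H : HasFDerivAt (pullF0 L g) _ (t, (res q : Jet n (k+k+1))) :=
    HasFDerivAt.comp (t, (res q : Jet n (k+k+1))) (hg (t, F0 L (res q))).hasFDerivAt hp
  rw [Dt, H.fderiv]
  rfl

theorem dot_gradMom {n k : ℕ} (g : ℝ × (Jet n (k+k) × Vec n) → ℝ)
    (x : ℝ × (Jet n (k+k) × Vec n)) (v : Vec n) :
    dot v (gradMom g x) = fderiv ℝ g x (0, 0, v) := by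
  let φ : Vec n →ₗ[ℝ] ℝ := (fderiv ℝ g x).toLinearMap ∘ₗ
    LinearMap.inr ℝ ℝ (Jet n (k+k) × Vec n) ∘ₗ LinearMap.inr ℝ (Jet n (k+k)) (Vec n)
  have h := φ.pi_apply_eq_sum_univ v
  have e (i : Fin n) : (fun j => if i = j then (1 : ℝ) else 0) = Pi.single i 1 := by
    ext j; simp [Pi.single_apply, eq_comm]
  simp only [e, smul_eq_mul] at h
  exact h.symm

theorem dot_add_right {n : ℕ} (u v w : Vec n) : dot u (v + w) = dot u v + dot u w :=
  dotProduct_add u v w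

theorem dot_sum_smul_right {n : ℕ} {ι : Type*} [Fintype ι] (u : Vec n) (c : ι → ℝ)
    (v : ι → Vec n) : dot u (∑ i, c i • v i) = ∑ i, c i * dot u (v i) := by
  change u ⬝ᵥ _ = ∑ i, c i * (u ⬝ᵥ v i)
  simp [dotProduct_sum]

/-- converse part of Theorem 1.
Given `G_I(t,q₀,…,q_{2k},p⁰)` on the intermediate space `P₁`, kernel vector
fields `γ_μ` of the Hessian `W`, and functions `r^μ` with
`K₀·G_I + Σ_μ r^μ ⟨[L],γ_μ⟩ = 0` identically, the transformation
`δq = (∂G_I/∂p⁰)∘F₀ + Σ_μ r^μ γ_μ` is a Noether transformation with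
conserved quantity `G_L = G_I∘F₀`, i.e. `⟨[L],δq⟩ + D_t(G_I∘F₀) = 0`. -/
theorem noether_transformation_from_intermediate_function
    (n k m : ℕ) (hn : 1 ≤ n)
    (L : Jet n (k+1) → ℝ) (hL : ContDiff ℝ (⊤ : ℕ∞) L)
    (GI : ℝ × (Jet n (k+k) × Vec n) → ℝ) (hGI : ContDiff ℝ (⊤ : ℕ∞) GI)
    (γ : Fin m → Jet n (k+1) → Vec n) (hγ : ∀ μ, ContDiff ℝ (⊤ : ℕ∞) (γ μ))
    (hker : ∀ (μ : Fin m) (q : Jet n (k+1)), hessOp L q (γ μ q) = 0)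
    (r : Fin m → ℝ × Jet n (k+k+1) → ℝ) (hr : ∀ μ, ContDiff ℝ (⊤ : ℕ∞) (r μ))
    (hid : ∀ (t : ℝ) (q : Jet n (k+k+2)),
      K0 L GI (t, res q) +
        ∑ μ, r μ (t, res q) * dot (EL L q) (γ μ (trunc (by omega) q)) = 0) :
    ∀ (t : ℝ) (q : Jet n (k+k+2)),
      dot (EL L q)
          (gradMom GI (t, F0 L (res q)) +
            ∑ μ, r μ (t, res q) • γ μ (trunc (by omega) q)) +
        Dt (pullF0 L GI) (t, q) = 0 := by
  intro t q
  have hE := EL_eq_gradSlot_sub_Dt0_mom hL q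
  have h := hid t q
  have hK : K0 L GI (t, res q) = fderiv ℝ GI (t, F0 L (res q)) (0, 0, EL L q) +
      Dt (pullF0 L GI) (t, q) := by
    rw [Dt_pullF0 hL (hGI.differentiable (by simp)), ← map_add, hE]
    simp only [Prod.mk_add_mk, zero_add, sub_add_cancel]
    rfl
  rw [dot_add_right, dot_sum_smul_right, dot_gradMom]
  linarith

end
end

section
/- For the curvature Lagrangian L(x₀,x₁,x₂) = α√δ₂/δ₁, the Hessian W(x₀,x₁,x₂) — the second derivative of L with respect to x₂, a symmetric bilinear form on ℝ^d — satisfies, at every point with δ₁ > 0 and δ₂ > 0: W(u,v) = (α/√δ₂)[ B(u,v) − B(ξ₁,u)B(ξ₁,v)/(ξ₁ ξ₁) − B(ξ₂,u)B(ξ₂,v)/(ξ₂ ξ₂) ] for all u,v ∈ ℝ^d; moreover the radical { u : W(u,v) = 0 for all v } is exactly the linear span of x₁ and x₂, so W has rank d − 2. -/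
open scoped BigOperators Matrix

noncomputable section

/-- `V d` is `ℝ^d`. -/
abbrev V (d : ℕ) := Fin d → ℝ

variable {d : ℕ}

/-- The bilinear form determined by the symmetric matrix `B`:
`(u v) = B(u,v) = uᵀ B v`. -/
def bf (B : Matrix (Fin d) (Fin d) ℝ) (u v : V d) : ℝ := u ⬝ᵥ B *ᵥ v

/-- The Gram determinant of a family of vectors with respect to `B`. -/
def gram (B : Matrix (Fin d) (Fin d) ℝ) {m : ℕ} (x : Fin m → V d) : ℝ :=
  (Matrix.of fun i j => bf B (x i) (x j)).det

/-- `δ₁ = (x₁ x₁)` as a `1×1` Gram determinant. -/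
def d1 (B : Matrix (Fin d) (Fin d) ℝ) (x1 : V d) : ℝ := gram B ![x1]

/-- `δ₂`, the Gram determinant of `x₁, x₂`. -/
def d2 (B : Matrix (Fin d) (Fin d) ℝ) (x1 x2 : V d) : ℝ := gram B ![x1, x2]

/-- `δ₃`, the Gram determinant of `x₁, x₂, x₃`. -/
def d3 (B : Matrix (Fin d) (Fin d) ℝ) (x1 x2 x3 : V d) : ℝ := gram B ![x1, x2, x3]

/-- The orthogonalized vector `ξ₂ = x₂ − ((x₂ ξ₁)/(ξ₁ ξ₁)) ξ₁` (with `ξ₁ = x₁`). -/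
def xi2 (B : Matrix (Fin d) (Fin d) ℝ) (x1 x2 : V d) : V d :=
  x2 - (bf B x2 x1 / bf B x1 x1) • x1

/-- The orthogonalized vector
`ξ₃ = x₃ − ((x₃ ξ₂)/(ξ₂ ξ₂)) ξ₂ − ((x₃ ξ₁)/(ξ₁ ξ₁)) ξ₁`. -/
def xi3 (B : Matrix (Fin d) (Fin d) ℝ) (x1 x2 x3 : V d) : V d :=
  x3 - (bf B x3 (xi2 B x1 x2) / bf B (xi2 B x1 x2) (xi2 B x1 x2)) • xi2 B x1 x2
     - (bf B x3 x1 / bf B x1 x1) • x1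

/-- The curvature Lagrangian `L(x₀,x₁,x₂) = α √δ₂ / δ₁` of the relativistic
particle (independent of `x₀`). -/
def Lc (B : Matrix (Fin d) (Fin d) ℝ) (α : ℝ) (x : V d × V d × V d) : ℝ :=
  α * Real.sqrt (d2 B x.2.1 x.2.2) / d1 B x.2.1

/-- The Ostrogradskii momentum `p̂¹`, identified with a vector via `B`:
the (for nondegenerate symmetric `B`, unique) vector with
`B(p̂¹,v) = (∂L/∂x₂)[v]` for all `v`. -/
def p1h (B : Matrix (Fin d) (Fin d) ℝ) (α : ℝ) (x0 x1 x2 : V d) : V d :=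
  B⁻¹ *ᵥ fun a => fderiv ℝ (Lc B α) (x0, x1, x2) (0, 0, Pi.single a 1)

/-- The Ostrogradskii momentum `p̂⁰`, identified with a vector via `B`:
the vector with `B(p̂⁰,v) = (∂L/∂x₁)[v] − (D_t B(p̂¹,·))[v]` for all `v`. -/
def p0h (B : Matrix (Fin d) (Fin d) ℝ) (α : ℝ) (x0 x1 x2 x3 : V d) : V d :=
  B⁻¹ *ᵥ fun a =>
    fderiv ℝ (Lc B α) (x0, x1, x2) (0, Pi.single a 1, 0) -
      fderiv ℝ (fun y : V d × V d × V d =>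
          bf B (p1h B α y.1 y.2.1 y.2.2) (Pi.single a 1))
        (x0, x1, x2) (x1, x2, x3)

/-- The Euler–Lagrange expression `[L] = ∂L/∂x₀ − D_t(B(p̂⁰,·))` as a covector,
evaluated on the vector `v`. -/
def ELc (B : Matrix (Fin d) (Fin d) ℝ) (α : ℝ) (x0 x1 x2 x3 x4 : V d) (v : V d) : ℝ :=
  fderiv ℝ (Lc B α) (x0, x1, x2) (v, 0, 0) -
    fderiv ℝ (fun y : V d × V d × V d × V d =>
        bf B (p0h B α y.1 y.2.1 y.2.2.1 y.2.2.2) v)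
      (x0, x1, x2, x3) (x1, x2, x3, x4)

/-- The formal total time derivative of a time-dependent function
`f(t,x₀,x₁,x₂,x₃)`, a function of `(t,x₀,…,x₄)`. -/
def DtT (f : ℝ × (V d × V d × V d × V d) → ℝ)
    (t : ℝ) (x0 x1 x2 x3 x4 : V d) : ℝ :=
  fderiv ℝ f (t, (x0, x1, x2, x3)) (1, (x1, x2, x3, x4))

/-- The Hessian `W = ∂²L/∂x₂∂x₂` of the curvature Lagrangian, as a bilinear
form `W(u,v)` on `ℝ^d` (a function of `(x₀,x₁,x₂)`). -/
def Wc (B : Matrix (Fin d) (Fin d) ℝ) (α : ℝ) (x0 x1 x2 : V d) (u v : V d) : ℝ :=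
  fderiv ℝ (fun x2' => fderiv ℝ (Lc B α) (x0, x1, x2') (0, 0, v)) x2 u

section BilinearForm

variable (B : Matrix (Fin d) (Fin d) ℝ)

lemma bf_add_left (u u' v : V d) : bf B (u + u') v = bf B u v + bf B u' v := by
  simp [bf]

lemma bf_add_right (u v v' : V d) : bf B u (v + v') = bf B u v + bf B u v' := by
  simp [bf, Matrix.mulVec_add]

lemma bf_sub_left (u u' v : V d) : bf B (u - u') v = bf B u v - bf B u' v := by
  simp [bf]

lemma bf_smul_left (c : ℝ) (u v : V d) : bf B (c • u) v = c * bf B u v := by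
  simp [bf]

lemma bf_smul_right (c : ℝ) (u v : V d) : bf B u (c • v) = c * bf B u v := by
  simp [bf, Matrix.mulVec_smul]

lemma bf_zero_right (u : V d) : bf B u 0 = 0 := by
  simp [bf]

variable {B}

lemma bf_comm (hB : B.IsSymm) (u v : V d) : bf B u v = bf B v u := by
  rw [bf, bf, Matrix.dotProduct_mulVec, dotProduct_comm, ← Matrix.mulVec_transpose, hB.eq]

/-- A symmetric invertible matrix gives a nondegenerate form. -/
lemma eq_zero_of_forall_bf_eq_zero (hB : B.IsSymm) (hdet : IsUnit B.det) {w : V d}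
    (h : ∀ v, bf B w v = 0) : w = 0 := by
  have hw : B *ᵥ w = 0 := by
    refine dotProduct_eq_zero _ fun v => ?_
    rw [dotProduct_comm]
    exact (bf_comm hB v w).trans (h v)
  exact (Matrix.mulVec_injective_iff_isUnit.2 ((Matrix.isUnit_iff_isUnit_det B).2 hdet))
    (by rw [hw, Matrix.mulVec_zero])

lemma differentiable_bf {E : Type*} [NormedAddCommGroup E] [NormedSpace ℝ E] {f g : E → V d}
    (hf : Differentiable ℝ f) (hg : Differentiable ℝ g) :
    Differentiable ℝ fun y => bf B (f y) (g y) := by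
  simp only [bf, dotProduct, Matrix.mulVec]
  fun_prop

lemma d1_eq_bf (x1 : V d) : d1 B x1 = bf B x1 x1 := by
  simp [d1, gram]

lemma d2_eq_bf (x1 x2 : V d) :
    d2 B x1 x2 = bf B x1 x1 * bf B x2 x2 - bf B x1 x2 * bf B x2 x1 := by
  simp [d2, gram, Matrix.det_fin_two]

lemma bf_xi2_left (x1 x2 v : V d) :
    bf B (xi2 B x1 x2) v = bf B x2 v - bf B x2 x1 / bf B x1 x1 * bf B x1 v := by
  rw [xi2, bf_sub_left, bf_smul_left]

lemma bf_xi2_self_left {x1 : V d} (h1 : bf B x1 x1 ≠ 0) (x2 : V d) :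
    bf B (xi2 B x1 x2) x1 = 0 := by
  rw [bf_xi2_left, div_mul_cancel₀ _ h1, sub_self]

lemma bf_xi2_xi2 (hB : B.IsSymm) {x1 : V d} (h1 : bf B x1 x1 ≠ 0) (x2 : V d) :
    bf B (xi2 B x1 x2) (xi2 B x1 x2) = d2 B x1 x2 / bf B x1 x1 := by
  rw [bf_xi2_left, bf_comm hB x2 (xi2 B x1 x2), bf_comm hB x1 (xi2 B x1 x2),
    bf_xi2_self_left h1, bf_xi2_left, d2_eq_bf, bf_comm hB x2 x1]
  field_simp
  ring

lemma linearIndependent_of_d2_ne_zero {x1 x2 : V d} (h2 : d2 B x1 x2 ≠ 0) :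
    LinearIndependent ℝ ![x1, x2] := by
  rw [LinearIndependent.pair_iff]
  intro s t hst
  have e1 : s * bf B x1 x1 + t * bf B x1 x2 = 0 := by
    rw [← bf_smul_right, ← bf_smul_right, ← bf_add_right, hst, bf_zero_right]
  have e2 : s * bf B x2 x1 + t * bf B x2 x2 = 0 := by
    rw [← bf_smul_right, ← bf_smul_right, ← bf_add_right, hst, bf_zero_right]
  rw [d2_eq_bf] at h2
  constructor
  · refine (mul_eq_zero.1 ?_).resolve_right h2
    linear_combination bf B x2 x2 * e1 - bf B x1 x2 * e2
  · refine (mul_eq_zero.1 ?_).resolve_right h2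
    linear_combination bf B x1 x1 * e2 - bf B x2 x1 * e1

end BilinearForm

section Derivatives

variable {B : Matrix (Fin d) (Fin d) ℝ}

lemma differentiable_d1 {E : Type*} [NormedAddCommGroup E] [NormedSpace ℝ E] {f : E → V d}
    (hf : Differentiable ℝ f) : Differentiable ℝ fun y => d1 B (f y) := by
  simp only [d1_eq_bf]
  exact differentiable_bf hf hf

lemma differentiable_d2 {E : Type*} [NormedAddCommGroup E] [NormedSpace ℝ E] {f g : E → V d}
    (hf : Differentiable ℝ f) (hg : Differentiable ℝ g) :
    Differentiable ℝ fun y => d2 B (f y) (g y) := by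
  simp only [d2_eq_bf]
  exact ((differentiable_bf hf hf).mul (differentiable_bf hg hg)).sub
    ((differentiable_bf hf hg).mul (differentiable_bf hg hf))

lemma hasDerivAt_bf_line_left (y v w : V d) :
    HasDerivAt (fun t : ℝ => bf B (y + t • v) w) (bf B v w) 0 := by
  simp only [bf_add_left, bf_smul_left]
  simpa using ((hasDerivAt_id (0 : ℝ)).mul_const (bf B v w)).const_add (bf B y w)

lemma hasDerivAt_d2_line (hB : B.IsSymm) {x1 : V d} (h1 : bf B x1 x1 ≠ 0) (y v : V d) :
    HasDerivAt (fun t : ℝ => d2 B x1 (y + t • v))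
      (2 * bf B x1 x1 * bf B (xi2 B x1 y) v) 0 := by
  have hline : (fun t : ℝ => d2 B x1 (y + t • v)) = fun t =>
      d2 B x1 y + (t * (2 * bf B x1 x1 * bf B (xi2 B x1 y) v) + t ^ 2 * d2 B x1 v) := by
    funext t
    simp only [d2_eq_bf, bf_xi2_left, bf_add_left, bf_add_right, bf_smul_left, bf_smul_right,
      bf_comm hB v y, bf_comm hB y x1, bf_comm hB v x1]
    field_simp
    ring
  rw [hline]
  simpa using (((hasDerivAt_id (0 : ℝ)).mul_const (2 * bf B x1 x1 * bf B (xi2 B x1 y) v)).fun_add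
    ((hasDerivAt_pow 2 (0 : ℝ)).mul_const (d2 B x1 v))).const_add (d2 B x1 y)

lemma differentiableAt_Lc (α : ℝ) {x : V d × V d × V d} (h1 : d1 B x.2.1 ≠ 0)
    (h2 : d2 B x.2.1 x.2.2 ≠ 0) : DifferentiableAt ℝ (Lc B α) x := by
  have e1 : DifferentiableAt ℝ (fun y : V d × V d × V d => d1 B y.2.1) x :=
    differentiable_d1 (by fun_prop) x
  have e2 : DifferentiableAt ℝ (fun y : V d × V d × V d => d2 B y.2.1 y.2.2) x :=
    differentiable_d2 (by fun_prop) (by fun_prop) x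
  have hL : Lc B α = fun y => α * Real.sqrt (d2 B y.2.1 y.2.2) * (d1 B y.2.1)⁻¹ :=
    funext fun y => div_eq_mul_inv _ _
  rw [hL]
  exact ((e2.sqrt h2).const_mul α).fun_mul (e1.fun_inv h1)

lemma fderiv_Lc_acceleration (hB : B.IsSymm) (α : ℝ) (x0 : V d) {x1 y : V d}
    (h1 : bf B x1 x1 ≠ 0) (h2 : d2 B x1 y ≠ 0) (v : V d) :
    fderiv ℝ (Lc B α) (x0, x1, y) (0, 0, v) =
      α * bf B (xi2 B x1 y) v / Real.sqrt (d2 B x1 y) := by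
  have hL : DifferentiableAt ℝ (Lc B α) (x0, x1, y) :=
    differentiableAt_Lc α (by rwa [d1_eq_bf]) h2
  rw [← hL.lineDeriv_eq_fderiv]
  refine HasDerivAt.deriv ?_
  have h := (((hasDerivAt_d2_line hB h1 y v).sqrt (by simpa using h2)).const_mul α).div_const
    (bf B x1 x1)
  have hline : (fun t : ℝ => Lc B α ((x0, x1, y) + t • (0, 0, v))) =
      fun t => α * Real.sqrt (d2 B x1 (y + t • v)) / bf B x1 x1 := by
    funext t
    simp [Lc, d1_eq_bf]
  rw [hline]
  refine h.congr_deriv ?_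
  simp only [zero_smul, add_zero]
  field_simp

lemma Wc_eq (hB : B.IsSymm) (α : ℝ) (x0 : V d) {x1 x2 : V d}
    (h1 : bf B x1 x1 ≠ 0) (h2 : 0 < d2 B x1 x2) (u v : V d) :
    Wc B α x0 x1 x2 u v =
      α / Real.sqrt (d2 B x1 x2) *
        (bf B u v - bf B x1 u * bf B x1 v / bf B x1 x1 -
          bf B (xi2 B x1 x2) u * bf B (xi2 B x1 x2) v /
            bf B (xi2 B x1 x2) (xi2 B x1 x2)) := by
  have hd2 : Differentiable ℝ fun y => d2 B x1 y :=
    differentiable_d2 (by fun_prop) differentiable_id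
  have hev : (fun y => fderiv ℝ (Lc B α) (x0, x1, y) (0, 0, v)) =ᶠ[nhds x2]
      fun y => α * bf B (xi2 B x1 y) v / Real.sqrt (d2 B x1 y) := by
    filter_upwards [hd2.continuous.continuousAt.eventually_ne h2.ne'] with y hy
    exact fderiv_Lc_acceleration hB α x0 h1 hy v
  have hs : Real.sqrt (d2 B x1 x2) ≠ 0 := (Real.sqrt_pos.2 h2).ne'
  have hxi : Differentiable ℝ fun y => bf B (xi2 B x1 y) v := by
    simp only [bf_xi2_left]
    exact (differentiable_bf differentiable_id (differentiable_const v)).sub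
      (((differentiable_bf differentiable_id (differentiable_const x1)).mul_const _).mul_const _)
  have hdiff : DifferentiableAt ℝ
      (fun y => α * bf B (xi2 B x1 y) v / Real.sqrt (d2 B x1 y)) x2 := by
    simp only [div_eq_mul_inv]
    exact ((hxi x2).const_mul α).fun_mul (((hd2 x2).sqrt h2.ne').fun_inv hs)
  rw [Wc, hev.fderiv_eq, ← hdiff.lineDeriv_eq_fderiv]
  refine HasDerivAt.deriv ?_
  have hnum : HasDerivAt (fun t : ℝ => bf B (xi2 B x1 (x2 + t • u)) v)
      (bf B u v - bf B u x1 / bf B x1 x1 * bf B x1 v) 0 := by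
    simp only [bf_xi2_left]
    exact (hasDerivAt_bf_line_left x2 u v).sub
      (((hasDerivAt_bf_line_left x2 u x1).div_const _).mul_const _)
  have h := (hnum.const_mul α).fun_div
    ((hasDerivAt_d2_line hB h1 x2 u).sqrt (by simpa using h2.ne')) (by simpa using hs)
  refine h.congr_deriv ?_
  simp only [zero_smul, add_zero]
  rw [bf_xi2_xi2 hB h1, bf_comm hB u x1]
  obtain ⟨s, hs', hsq⟩ : ∃ s, Real.sqrt (d2 B x1 x2) = s ∧ d2 B x1 x2 = s ^ 2 :=
    ⟨_, rfl, (Real.sq_sqrt h2.le).symm⟩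
  rw [hs'] at hs ⊢
  rw [hsq]
  field_simp

end Derivatives

section Projection

variable {B : Matrix (Fin d) (Fin d) ℝ}

/-- The matrix of the bilinear form `(u, v) ↦ B(P u, v)`, where `P` is the `B`-orthogonal
projection along the plane spanned by `x₁` and `x₂`. -/
def planeComplementForm (B : Matrix (Fin d) (Fin d) ℝ) (x1 x2 : V d) :
    Matrix (Fin d) (Fin d) ℝ :=
  B - (bf B x1 x1)⁻¹ • Matrix.vecMulVec (x1 ᵥ* B) (x1 ᵥ* B) -
    (bf B (xi2 B x1 x2) (xi2 B x1 x2))⁻¹ •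
      Matrix.vecMulVec (xi2 B x1 x2 ᵥ* B) (xi2 B x1 x2 ᵥ* B)

lemma bf_planeComplementForm (x1 x2 u v : V d) :
    bf (planeComplementForm B x1 x2) u v =
      bf B u v - bf B x1 u * bf B x1 v / bf B x1 x1 -
        bf B (xi2 B x1 x2) u * bf B (xi2 B x1 x2) v /
          bf B (xi2 B x1 x2) (xi2 B x1 x2) := by
  have key (c : ℝ) (w : V d) :
      u ⬝ᵥ (c⁻¹ • Matrix.vecMulVec (w ᵥ* B) (w ᵥ* B)) *ᵥ v = bf B w u * bf B w v / c := by
    rw [Matrix.smul_mulVec, Matrix.vecMulVec_mulVec, dotProduct_smul, dotProduct_smul,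
      dotProduct_comm u, ← Matrix.dotProduct_mulVec, ← Matrix.dotProduct_mulVec, ← bf, ← bf,
      smul_eq_mul, MulOpposite.smul_eq_mul_unop, MulOpposite.unop_op]
    ring
  rw [← key, ← key, bf, planeComplementForm, Matrix.sub_mulVec, Matrix.sub_mulVec,
    dotProduct_sub, dotProduct_sub, ← bf]

lemma forall_bf_planeComplementForm_eq_zero_iff (hB : B.IsSymm) (hdet : IsUnit B.det)
    {x1 x2 : V d} (h1 : bf B x1 x1 ≠ 0) (h2 : d2 B x1 x2 ≠ 0) (u : V d) :
    (∀ v, bf (planeComplementForm B x1 x2) u v = 0) ↔ u ∈ Submodule.span ℝ {x1, x2} := by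
  have hxi : bf B (xi2 B x1 x2) (xi2 B x1 x2) ≠ 0 := by
    rw [bf_xi2_xi2 hB h1]
    exact div_ne_zero h2 h1
  simp only [Submodule.mem_span_pair]
  constructor
  · intro h
    set p := bf B x1 u / bf B x1 x1
    set q := bf B (xi2 B x1 x2) u / bf B (xi2 B x1 x2) (xi2 B x1 x2)
    have hu : u - p • x1 - q • xi2 B x1 x2 = 0 := by
      refine eq_zero_of_forall_bf_eq_zero hB hdet fun v => ?_
      rw [← h v, bf_planeComplementForm, bf_sub_left, bf_sub_left, bf_smul_left, bf_smul_left]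
      ring
    refine ⟨p - q * (bf B x2 x1 / bf B x1 x1), q, ?_⟩
    rw [← sub_eq_zero, ← neg_eq_zero, ← hu, xi2]
    module
  · rintro ⟨s, t, rfl⟩ v
    have hx2 : s • x1 + t • x2 =
        (s + t * (bf B x2 x1 / bf B x1 x1)) • x1 + t • xi2 B x1 x2 := by
      rw [xi2]
      module
    rw [hx2, bf_planeComplementForm]
    simp only [bf_add_left, bf_add_right, bf_smul_left, bf_smul_right,
      bf_comm hB x1 (xi2 B x1 x2), bf_xi2_self_left h1]
    field_simp
    ring

lemma planeComplementForm_comm (hB : B.IsSymm) (x1 x2 u v : V d) :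
    bf (planeComplementForm B x1 x2) u v = bf (planeComplementForm B x1 x2) v u := by
  rw [bf_planeComplementForm, bf_planeComplementForm, bf_comm hB u v]
  ring

lemma rank_planeComplementForm (hB : B.IsSymm) (hdet : IsUnit B.det) {x1 x2 : V d}
    (h1 : bf B x1 x1 ≠ 0) (h2 : d2 B x1 x2 ≠ 0) :
    (planeComplementForm B x1 x2).rank = d - 2 := by
  have hker : LinearMap.ker (planeComplementForm B x1 x2).mulVecLin =
      Submodule.span ℝ {x1, x2} := by
    ext u
    rw [← forall_bf_planeComplementForm_eq_zero_iff hB hdet h1 h2, LinearMap.mem_ker,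
      Matrix.mulVecLin_apply, ← dotProduct_eq_zero_iff]
    refine forall_congr' fun v => ?_
    rw [planeComplementForm_comm hB, bf, dotProduct_comm]
  have hspan : Module.finrank ℝ (Submodule.span ℝ {x1, x2}) = 2 := by
    rw [← Matrix.range_cons_cons_empty x1 x2 ![],
      finrank_span_eq_card (linearIndependent_of_d2_ne_zero h2), Fintype.card_fin]
  have hrn := LinearMap.finrank_range_add_finrank_ker (planeComplementForm B x1 x2).mulVecLin
  rw [hker, hspan, Module.finrank_fin_fun] at hrn
  exact Nat.eq_sub_of_add_eq hrn

end Projection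

/-- For the curvature Lagrangian `L = α√δ₂/δ₁`, at every
point with `δ₁ > 0` and `δ₂ > 0`:
`W(u,v) = (α/√δ₂)[B(u,v) − B(ξ₁,u)B(ξ₁,v)/(ξ₁ξ₁) − B(ξ₂,u)B(ξ₂,v)/(ξ₂ξ₂)]`;
the radical of `W` is exactly the span of `x₁` and `x₂`; and `W` has rank
`d − 2`. -/
theorem curvature_hessian
    (d : ℕ) (hd : 3 ≤ d) (B : Matrix (Fin d) (Fin d) ℝ)
    (hBsymm : B.IsSymm) (hBnd : IsUnit B.det)
    (α : ℝ) (hα : α ≠ 0)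
    (x0 x1 x2 : V d) (h1 : 0 < d1 B x1) (h2 : 0 < d2 B x1 x2) :
    (∀ u v : V d,
      Wc B α x0 x1 x2 u v =
        α / Real.sqrt (d2 B x1 x2) *
          (bf B u v - bf B x1 u * bf B x1 v / bf B x1 x1 -
            bf B (xi2 B x1 x2) u * bf B (xi2 B x1 x2) v /
              bf B (xi2 B x1 x2) (xi2 B x1 x2))) ∧
    {u : V d | ∀ v : V d, Wc B α x0 x1 x2 u v = 0} =
      ↑(Submodule.span ℝ ({x1, x2} : Set (V d))) ∧
    (Matrix.of fun a b : Fin d =>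
        Wc B α x0 x1 x2 (Pi.single a 1) (Pi.single b 1)).rank = d - 2 := by
  have h1' : bf B x1 x1 ≠ 0 := by
    rw [← d1_eq_bf]
    exact h1.ne'
  have hc : α / Real.sqrt (d2 B x1 x2) ≠ 0 := div_ne_zero hα (Real.sqrt_pos.2 h2).ne'
  have hW (u v : V d) : Wc B α x0 x1 x2 u v =
      α / Real.sqrt (d2 B x1 x2) * bf (planeComplementForm B x1 x2) u v := by
    rw [Wc_eq hBsymm α x0 h1' h2, bf_planeComplementForm]
  refine ⟨Wc_eq hBsymm α x0 h1' h2, ?_, ?_⟩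
  · ext u
    simp only [hW, mul_eq_zero, hc, false_or, Set.mem_ofPred_eq, SetLike.mem_coe]
    exact forall_bf_planeComplementForm_eq_zero_iff hBsymm hBnd h1' h2.ne' u
  · have hM : (Matrix.of fun a b : Fin d =>
        Wc B α x0 x1 x2 (Pi.single a 1) (Pi.single b 1)) =
          (α / Real.sqrt (d2 B x1 x2)) • planeComplementForm B x1 x2 := by
      ext a b
      simp [hW, bf]
    rw [hM, Matrix.rank_smul_of_mem_nonZeroDivisors _ (mem_nonZeroDivisors_of_ne_zero hc)]
    exact rank_planeComplementForm hBsymm hBnd h1' h2.ne'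

end
end
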